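/- For every complex number z and every complex q with |q| < 1, ∑_{n=0}^{∞} z^n q^{n²} / (-q;q)_n = (1/(-q;q)_∞) · ∑_{n=0}^{∞} q^{n(n+1)/2} ∑_{i=0}^{n} z^i q^{i(i-1)/2} / (q;q)_{n-i}. -/

import Mathlib

open scoped BigOperators

/-- The finite q-Pochhammer symbol `(a;q)_n`. -/
noncomputable def qPoch (a q : ℂ) (n : ℕ) : ℂ := ∏ k ∈ Finset.range n, (1 - a * q ^ k)

/-- The infinite q-Pochhammer symbol `(a;q)_∞`. -/
noncomputable def qPochInf (a q : ℂ) : ℂ := ∏' k : ℕ, (1 - a * q ^ k)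

open Filter Topology in
/-- The ratio test for sequences whose successive ratios tend to zero. -/
theorem summable_of_ratio_tendsto_zero {f r : ℕ → ℂ} (hf : ∀ n, f (n + 1) = r n * f n)
    (hr : Tendsto r atTop (𝓝 0)) : Summable f := by
  refine summable_of_ratio_norm_eventually_le (r := 1 / 2) (by norm_num) ?_
  have h : ∀ᶠ n in atTop, ‖r n‖ < 1 / 2 := by
    simpa using (tendsto_zero_iff_norm_tendsto_zero.mp hr).eventually_lt_const
      (by norm_num : (0 : ℝ) < 1 / 2)
  filter_upwards [h] with n hn
  rw [hf, norm_mul]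
  gcongr

/-- Summing over `ℕ × ℕ` along antidiagonals. -/
theorem tsum_sum_range_eq_tsum_tsum {f : ℕ × ℕ → ℂ} (hf : Summable f) :
    ∑' n : ℕ, ∑ i ∈ Finset.range (n + 1), f (i, n - i) = ∑' (i : ℕ) (m : ℕ), f (i, m) := by
  rw [← hf.tsum_prod,
    ← Finset.HasAntidiagonal.sigmaAntidiagonalEquivProd.tsum_eq f,
    Summable.tsum_sigma' (f := fun c ↦ f (Finset.HasAntidiagonal.sigmaAntidiagonalEquivProd c))
      (fun n ↦ (hasSum_fintype _).summable)
      (Finset.HasAntidiagonal.sigmaAntidiagonalEquivProd.summable_iff.mpr hf)]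
  refine tsum_congr fun n ↦ ?_
  rw [tsum_fintype, ← Finset.Nat.sum_antidiagonal_eq_sum_range_succ_mk]
  exact (Finset.sum_finset_coe f _).symm

section QSeries

variable {q : ℂ}

theorem qPoch_succ (a q : ℂ) (n : ℕ) : qPoch a q (n + 1) = qPoch a q n * (1 - a * q ^ n) :=
  Finset.prod_range_succ _ _

theorem one_sub_ne_zero_of_norm_lt_one {a : ℂ} (ha : ‖a‖ < 1) : 1 - a ≠ 0 := by
  intro h
  rw [← sub_eq_zero.mp h] at ha
  simp at ha

theorem norm_mul_pow_lt_one {a : ℂ} (ha : ‖a‖ < 1) (hq : ‖q‖ < 1) (n : ℕ) : ‖a * q ^ n‖ < 1 := by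
  rw [norm_mul, norm_pow]
  exact mul_lt_one_of_nonneg_of_lt_one_left (norm_nonneg _) ha (pow_le_one₀ (norm_nonneg _) hq.le)

theorem summable_mul_pow (a : ℂ) (hq : ‖q‖ < 1) : Summable fun k : ℕ ↦ a * q ^ k :=
  (summable_geometric_of_norm_lt_one hq).mul_left a

theorem multipliable_one_sub_mul_pow (a : ℂ) (hq : ‖q‖ < 1) :
    Multipliable fun k : ℕ ↦ 1 - a * q ^ k := by
  simpa only [sub_eq_add_neg] using
    multipliable_one_add_of_summable (f := fun k : ℕ ↦ -(a * q ^ k))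
      (by simpa only [norm_neg] using (summable_mul_pow a hq).norm)

theorem qPochInf_ne_zero {a : ℂ} (ha : ‖a‖ < 1) (hq : ‖q‖ < 1) : qPochInf a q ≠ 0 := by
  have := tprod_one_add_ne_zero_of_summable (f := fun k : ℕ ↦ -(a * q ^ k))
    (fun k ↦ by
      simpa only [← sub_eq_add_neg] using
        one_sub_ne_zero_of_norm_lt_one (norm_mul_pow_lt_one ha hq k))
    (by simpa only [norm_neg] using (summable_mul_pow a hq).norm)
  simpa only [qPochInf, ← sub_eq_add_neg] using this

theorem qPoch_ne_zero {a : ℂ} (ha : ‖a‖ < 1) (hq : ‖q‖ < 1) (n : ℕ) : qPoch a q n ≠ 0 :=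
  Finset.prod_ne_zero_iff.mpr fun k _ ↦
    one_sub_ne_zero_of_norm_lt_one (norm_mul_pow_lt_one ha hq k)

theorem qPoch_mul_qPochInf (a : ℂ) (hq : ‖q‖ < 1) (n : ℕ) :
    qPoch a q n * qPochInf (a * q ^ n) q = qPochInf a q := by
  have h : (fun k : ℕ ↦ 1 - a * q ^ n * q ^ k) = fun k ↦ 1 - a * q ^ (k + n) := by
    funext k
    ring
  have hm := multipliable_one_sub_mul_pow (a * q ^ n) hq
  rw [qPochInf, h]
  rw [h] at hm
  exact Multipliable.prod_mul_tprod_nat_mul' (f := fun k ↦ 1 - a * q ^ k) hm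

/-- The general term of Euler's series for `(-x;q)_∞`. -/
noncomputable def eulerTerm (q x : ℂ) (m : ℕ) : ℂ := q ^ m.choose 2 * x ^ m / qPoch q q m

theorem eulerTerm_eq_mul_pow (q x : ℂ) (m : ℕ) : eulerTerm q x m = eulerTerm q 1 m * x ^ m := by
  simp only [eulerTerm, one_pow]
  ring

theorem eulerTerm_mul_self (q x : ℂ) (m : ℕ) : eulerTerm q (x * q) m = q ^ m * eulerTerm q x m := by
  simp only [eulerTerm]
  ring

theorem one_sub_pow_succ_mul_eulerTerm (hq : ‖q‖ < 1) (x : ℂ) (m : ℕ) :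
    (1 - q ^ (m + 1)) * eulerTerm q x (m + 1) = x * eulerTerm q (x * q) m := by
  have h := qPoch_ne_zero hq hq (m + 1)
  rw [qPoch_succ] at h
  have h₁ := left_ne_zero_of_mul h
  have h₂ := right_ne_zero_of_mul h
  rw [eulerTerm, eulerTerm, qPoch_succ, Nat.choose_succ_succ' m 1, Nat.choose_one_right]
  rw [pow_succ' q m]
  field_simp
  ring

open Filter Topology in
theorem summable_eulerTerm (hq : ‖q‖ < 1) (x : ℂ) : Summable (eulerTerm q x) := by
  have hpow := tendsto_pow_atTop_nhds_zero_of_norm_lt_one hq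
  refine summable_of_ratio_tendsto_zero (r := fun m ↦ x * q ^ m / (1 - q ^ (m + 1))) (fun m ↦ ?_) ?_
  · have h : 1 - q ^ (m + 1) ≠ 0 := by
      simpa only [pow_succ'] using one_sub_ne_zero_of_norm_lt_one (norm_mul_pow_lt_one hq hq m)
    have := one_sub_pow_succ_mul_eulerTerm hq x m
    rw [eulerTerm_mul_self] at this
    field_simp
    linear_combination this
  · simpa [Pi.div_def] using (hpow.const_mul x).div
      ((hpow.comp (tendsto_add_atTop_nat 1)).const_sub 1) (by simp)

theorem tsum_eulerTerm_eq_one_add_mul (hq : ‖q‖ < 1) (x : ℂ) :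
    ∑' m, eulerTerm q x m = (1 + x) * ∑' m, eulerTerm q (x * q) m := by
  have hs := summable_eulerTerm hq x
  have hs' := summable_eulerTerm hq (x * q)
  have hd : ∑' m, (eulerTerm q x m - eulerTerm q (x * q) m) = x * ∑' m, eulerTerm q (x * q) m := by
    rw [(hs.sub hs').tsum_eq_zero_add, ← tsum_mul_left]
    have h₀ : eulerTerm q x 0 - eulerTerm q (x * q) 0 = 0 := by simp [eulerTerm]
    rw [h₀, zero_add]
    refine tsum_congr fun m ↦ ?_
    rw [← one_sub_pow_succ_mul_eulerTerm hq, eulerTerm_mul_self]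
    ring
  rw [hs.tsum_sub hs'] at hd
  linear_combination hd

theorem tsum_eulerTerm_eq_qPoch_mul (hq : ‖q‖ < 1) (x : ℂ) (n : ℕ) :
    ∑' m, eulerTerm q x m = qPoch (-x) q n * ∑' m, eulerTerm q (x * q ^ n) m := by
  induction n with
  | zero => simp [qPoch]
  | succ n ih =>
    rw [ih, tsum_eulerTerm_eq_one_add_mul hq, qPoch_succ, pow_succ, mul_assoc x]
    ring

open Filter Topology in
/-- Euler's expansion of `(-x;q)_∞`. -/
theorem tsum_eulerTerm (hq : ‖q‖ < 1) (x : ℂ) : ∑' m, eulerTerm q x m = qPochInf (-x) q := by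
  have hpow := tendsto_pow_atTop_nhds_zero_of_norm_lt_one hq
  have hlim : Tendsto (fun n : ℕ ↦ ∑' m, eulerTerm q (x * q ^ n) m) atTop
      (𝓝 (∑' m, eulerTerm q 0 m)) := by
    refine tendsto_tsum_of_dominated_convergence (summable_eulerTerm hq x).norm (fun m ↦ ?_)
      (Eventually.of_forall fun n m ↦ ?_)
    · have hc : Continuous fun y : ℂ ↦ eulerTerm q y m := by
        unfold eulerTerm
        fun_prop
      exact (hc.tendsto 0).comp (by simpa using hpow.const_mul x)
    · rw [eulerTerm_eq_mul_pow, eulerTerm_eq_mul_pow q x, norm_mul, norm_mul, norm_pow, norm_pow,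
        norm_mul, norm_pow]
      gcongr
      exact mul_le_of_le_one_right (norm_nonneg _) (pow_le_one₀ (norm_nonneg _) hq.le)
  have hzero : ∑' m, eulerTerm q 0 m = 1 := by
    rw [tsum_eq_single 0 fun m hm ↦ by simp [eulerTerm, hm]]
    simp [eulerTerm, qPoch]
  have hprod := (multipliable_one_sub_mul_pow (-x) hq).tendsto_prod_tprod_nat.mul hlim
  rw [hzero, mul_one] at hprod
  refine tendsto_nhds_unique (tendsto_const_nhds.congr fun n ↦ ?_) hprod
  exact tsum_eulerTerm_eq_qPoch_mul hq x n

open Filter Topology in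
theorem summable_pow_mul_pow_sq (hq : ‖q‖ < 1) (z : ℂ) :
    Summable fun n : ℕ ↦ z ^ n * q ^ (n ^ 2) := by
  have hpow := tendsto_pow_atTop_nhds_zero_of_norm_lt_one hq
  refine summable_of_ratio_tendsto_zero (r := fun n ↦ z * q * (q ^ n * q ^ n)) (fun n ↦ by ring) ?_
  simpa using (hpow.mul hpow).const_mul (z * q)

theorem summable_mul_eulerTerm (hq : ‖q‖ < 1) (z : ℂ) :
    Summable fun p : ℕ × ℕ ↦
      z ^ p.1 * q ^ (p.1 ^ 2) * eulerTerm q (q * q ^ p.1) p.2 := by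
  have h := summable_mul_of_summable_norm (summable_pow_mul_pow_sq hq z).norm
    (summable_eulerTerm hq q).norm
  refine h.norm.of_norm_bounded fun p ↦ ?_
  rw [norm_mul, norm_mul _ (eulerTerm q q p.2), eulerTerm_eq_mul_pow, eulerTerm_eq_mul_pow q q,
    norm_mul (eulerTerm q 1 p.2), norm_mul (eulerTerm q 1 p.2), norm_pow _ p.2, norm_pow _ p.2,
    norm_mul q, norm_pow q p.1]
  gcongr
  exact mul_le_of_le_one_right (norm_nonneg _) (pow_le_one₀ (norm_nonneg _) hq.le)

theorem pow_triangle_mul_div_qPoch (z q : ℂ) {n i : ℕ} (hi : i ≤ n) :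
    q ^ (n * (n + 1) / 2) * (z ^ i * q ^ (i * (i - 1) / 2) / qPoch q q (n - i))
      = z ^ i * q ^ (i ^ 2) * eulerTerm q (q * q ^ i) (n - i) := by
  obtain ⟨m, rfl⟩ := Nat.exists_eq_add_of_le hi
  have hexp : (i + m) * (i + m + 1) / 2 + i * (i - 1) / 2
      = i ^ 2 + (m.choose 2 + (i + 1) * m) := by
    have hchoose : ∀ k : ℕ, 2 * (k * (k - 1) / 2) + k = k ^ 2 := fun k ↦ by
      rw [Nat.mul_div_cancel' (Nat.even_mul_pred_self k).two_dvd]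
      cases k <;> simp; ring
    have htri := Nat.mul_div_cancel' (Nat.even_mul_succ_self (i + m)).two_dvd
    rw [Nat.choose_two_right]
    linarith [hchoose i, hchoose m]
  rw [Nat.add_sub_cancel_left, eulerTerm]
  have : q ^ ((i + m) * (i + m + 1) / 2) * q ^ (i * (i - 1) / 2)
      = q ^ (i ^ 2) * (q ^ m.choose 2 * (q * q ^ i) ^ m) := by
    rw [← pow_add, hexp, pow_add, pow_add, ← pow_succ', ← pow_mul]
  linear_combination z ^ i / qPoch q q m * this

end QSeries

theorem conjugation_identity (z q : ℂ) (hq : ‖q‖ < 1) :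
    ∑' n : ℕ, z ^ n * q ^ (n ^ 2) / qPoch (-q) q n
      = (1 / qPochInf (-q) q) *
          ∑' n : ℕ, q ^ (n * (n + 1) / 2) *
            ∑ i ∈ Finset.range (n + 1),
              z ^ i * q ^ (i * (i - 1) / 2) / qPoch q q (n - i) := by
  have hq' : ‖-q‖ < 1 := by rwa [norm_neg]
  have hinf := qPochInf_ne_zero hq' hq
  have hrhs : ∑' n : ℕ, q ^ (n * (n + 1) / 2) *
      ∑ i ∈ Finset.range (n + 1), z ^ i * q ^ (i * (i - 1) / 2) / qPoch q q (n - i)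
      = ∑' i : ℕ, z ^ i * q ^ (i ^ 2) * qPochInf (-q * q ^ i) q := by
    simp_rw [neg_mul, ← tsum_eulerTerm hq, ← tsum_mul_left]
    rw [← tsum_sum_range_eq_tsum_tsum (summable_mul_eulerTerm hq z)]
    refine tsum_congr fun n ↦ ?_
    rw [Finset.mul_sum]
    exact Finset.sum_congr rfl fun i hi ↦
      pow_triangle_mul_div_qPoch z q (Finset.mem_range_succ_iff.mp hi)
  rw [hrhs, ← tsum_mul_left]
  refine tsum_congr fun n ↦ ?_
  have hn := qPoch_ne_zero hq' hq n
  rw [div_eq_iff hn, one_div, mul_assoc, eq_inv_mul_iff_mul_eq₀ hinf,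
    ← qPoch_mul_qPochInf (-q) hq n]
  ring
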